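/- Let α_1,…,α_{k−1} be positive stepsizes and 1 ≤ ℓ ≤ k−1. If the subsequences α_1,…,α_{ℓ−1} and α_{ℓ+1},…,α_{k−1} are both primitive, and α_ℓ = φ(α_1+⋯+α_{ℓ−1}, α_{ℓ+1}+⋯+α_{k−1}), then the full schedule α_1,…,α_{k−1} is primitive. -/

import Mathlib

open Finset
open scoped RealInnerProductSpace

noncomputable section

/-- Gradient-descent trajectory along a finite list of stepsizes. -/
def gdIter {E : Type*} [AddCommGroup E] [SMul ℝ E] (g : E → E) : E → List ℝ → E
  | x, [] => x
  | x, a :: L => gdIter g (x - a • g x) L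

/-- A finite stepsize schedule (of positive reals) is primitive if the key
gradient-descent inequality holds for every smooth convex problem instance. -/
def IsPrimitive (L : List ℝ) : Prop :=
  (∀ a ∈ L, (0:ℝ) < a) ∧
  ∀ (d : ℕ) (f : EuclideanSpace ℝ (Fin d) → ℝ)
    (g : EuclideanSpace ℝ (Fin d) → EuclideanSpace ℝ (Fin d)),
    ConvexOn ℝ Set.univ f →
    (∀ y, HasGradientAt f (g y) y) →
    LipschitzWith 1 g →
    ∀ xstar : EuclideanSpace ℝ (Fin d), IsMinOn f Set.univ xstar →
    ∀ x1 : EuclideanSpace ℝ (Fin d),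
      L.sum * (f (gdIter g x1 L) - f xstar)
        + (L.sum * (L.sum + 1) / 2) * ‖g (gdIter g x1 L)‖ ^ 2
        + 2⁻¹ * ‖gdIter g x1 L - xstar‖ ^ 2
      ≤ 2⁻¹ * ‖x1 - xstar‖ ^ 2
        + ∑ i : Fin L.length,
            L.get i *
              (f (gdIter g x1 (L.take i.1)) - f xstar
                - ⟪g (gdIter g x1 (L.take i.1)), gdIter g x1 (L.take i.1) - xstar⟫
                + 2⁻¹ * ‖g (gdIter g x1 (L.take i.1))‖ ^ 2)

/-- The join-stepsize function. -/
def phi (x y : ℝ) : ℝ :=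
  (-(x + y) + Real.sqrt ((x + y + 2) ^ 2 + 4 * (x + 1) * (y + 1))) / 2

/-- Concatenation of two stepsize schedules with the join stepsize in between. -/
def concatSched (s r : List ℝ) : List ℝ := s ++ phi s.sum r.sum :: r

/-- The silver stepsize schedules. -/
def silver : ℕ → List ℝ
  | 0 => []
  | i + 1 => concatSched (silver i) (silver i)

/-- Recursive concatenation of a sequence of schedules. -/
def concatAll (s : ℕ → List ℝ) : ℕ → List ℝ
  | 0 => []
  | i + 1 => concatSched (concatAll s i) (s (i + 1))

/-- The number of copies of the `j`-th silver schedule. -/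
def kSeq (c : ℝ) (j : ℕ) : ℕ := ⌊2 * (2:ℝ) ^ (c * j)⌋₊

def MSeq (c : ℝ) (j : ℕ) : ℕ := ∑ j' ∈ Finset.Icc 1 j, kSeq c j'

/-- The block index `j` of `i`, i.e. the `j` with `M_{j-1} < i ≤ M_j`. -/
def blockIdx (c : ℝ) (i : ℕ) : ℕ := sInf {j | i ≤ MSeq c j}

/-- The partially concatenated schedules `ŝ_i`. -/
def shatSched (c : ℝ) : ℕ → List ℝ := concatAll fun i => silver (blockIdx c i)

/-- The `t`-th entry (1-indexed) of the infinite limiting schedule `ŝ`. -/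
def shatEntry (c : ℝ) (t : ℕ) : ℝ := (shatSched c t).getD (t - 1) 0

section GradientInequalities

variable {E : Type*} [NormedAddCommGroup E] [InnerProductSpace ℝ E] [CompleteSpace E]
  {f : E → ℝ} {g : E → E}

lemma hasDerivAt_comp_line (hg : ∀ y, HasGradientAt f (g y) y) (x v : E) (t : ℝ) :
    HasDerivAt (fun t : ℝ => f (x + t • v)) ⟪g (x + t • v), v⟫ t := by
  have hline : HasDerivAt (fun t : ℝ => x + t • v) v t := by
    simpa using ((hasDerivAt_id t).smul_const v).const_add x
  exact (hg (x + t • v)).hasFDerivAt.comp_hasDerivAt t hline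

/-- First-order characterization of convexity. -/
lemma ConvexOn.add_inner_gradient_le (hf : ConvexOn ℝ Set.univ f)
    (hg : ∀ y, HasGradientAt f (g y) y) (x y : E) : f x + ⟪g x, y - x⟫ ≤ f y := by
  have hconv : ConvexOn ℝ Set.univ (fun t : ℝ => f (x + t • (y - x))) := by
    have heq : (fun t : ℝ => f (x + t • (y - x))) = f ∘ AffineMap.lineMap (k := ℝ) x y := by
      ext t
      simp [AffineMap.lineMap_apply, add_comm]
    rw [heq]
    exact hf.comp_affineMap (AffineMap.lineMap x y)
  have h := hconv.le_slope_of_hasDerivAt (Set.mem_univ 0) (Set.mem_univ 1) one_pos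
    (hasDerivAt_comp_line hg x (y - x) 0)
  simp [slope_def_field] at h
  linarith

/-- The descent lemma: a function with `1`-Lipschitz gradient has a quadratic upper bound. -/
lemma le_add_inner_gradient_add_sq (hg : ∀ y, HasGradientAt f (g y) y)
    (hlip : LipschitzWith 1 g) (x y : E) :
    f y ≤ f x + ⟪g x, y - x⟫ + 2⁻¹ * ‖y - x‖ ^ 2 := by
  set v := y - x with hv
  have hderiv (t : ℝ) : HasDerivAt
      (fun t : ℝ => f (x + t • v) - t * ⟪g x, v⟫ - 2⁻¹ * t ^ 2 * ‖v‖ ^ 2)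
      (⟪g (x + t • v), v⟫ - ⟪g x, v⟫ - t * ‖v‖ ^ 2) t := by
    refine (((hasDerivAt_comp_line hg x v t).sub ((hasDerivAt_id t).mul_const ⟪g x, v⟫)).sub
      ((((hasDerivAt_id t).pow 2).const_mul (2⁻¹ : ℝ)).mul_const (‖v‖ ^ 2))).congr_deriv ?_
    simp
  have hanti : AntitoneOn
      (fun t : ℝ => f (x + t • v) - t * ⟪g x, v⟫ - 2⁻¹ * t ^ 2 * ‖v‖ ^ 2) (Set.Icc 0 1) := by
    refine antitoneOn_of_deriv_nonpos (convex_Icc 0 1)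
      (fun t _ => (hderiv t).continuousAt.continuousWithinAt)
      (fun t _ => (hderiv t).differentiableAt.differentiableWithinAt) fun t ht => ?_
    rw [interior_Icc] at ht
    rw [(hderiv t).deriv, ← inner_sub_left]
    have hnorm : ‖g (x + t • v) - g x‖ ≤ t * ‖v‖ := by
      simpa [norm_smul, abs_of_pos ht.1] using hlip.norm_sub_le (x + t • v) x
    have h1 := real_inner_le_norm (g (x + t • v) - g x) v
    nlinarith [mul_le_mul_of_nonneg_right hnorm (norm_nonneg v)]
  have h := hanti (Set.left_mem_Icc.2 zero_le_one) (Set.right_mem_Icc.2 zero_le_one) zero_le_one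
  have hxy : x + v = y := by simp [hv]
  simp [hxy] at h
  linarith

/-- Convex functions with `1`-Lipschitz gradient satisfy the interpolation inequality. -/
lemma ConvexOn.add_inner_gradient_add_sq_le (hf : ConvexOn ℝ Set.univ f)
    (hg : ∀ y, HasGradientAt f (g y) y) (hlip : LipschitzWith 1 g) (x y : E) :
    f x + ⟪g x, y - x⟫ + 2⁻¹ * ‖g x - g y‖ ^ 2 ≤ f y := by
  have h1 := hf.add_inner_gradient_le hg x (y - (g y - g x))
  have h2 := le_add_inner_gradient_add_sq hg hlip y (y - (g y - g x))
  rw [show y - (g y - g x) - x = (y - x) - (g y - g x) by abel, inner_sub_right] at h1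
  rw [show y - (g y - g x) - y = -(g y - g x) by abel, inner_neg_right, norm_neg] at h2
  have h3 : ⟪g y, g y - g x⟫ - ⟪g x, g y - g x⟫ = ‖g y - g x‖ ^ 2 := by
    rw [← inner_sub_left, real_inner_self_eq_norm_sq]
  rw [norm_sub_rev]
  linarith

end GradientInequalities

section Trajectory

variable {E : Type*} [NormedAddCommGroup E] [InnerProductSpace ℝ E] {f : E → ℝ} {g : E → E}

lemma gdIter_append (g : E → E) (x : E) (s r : List ℝ) :
    gdIter g x (s ++ r) = gdIter g (gdIter g x s) r := by
  induction s generalizing x with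
  | nil => rfl
  | cons a s ih => exact ih _

/-- The weighted sum `∑ αᵢ (fᵢ + (1 - αᵢ) / 2 * ‖gᵢ‖²)` along a gradient-descent trajectory. -/
def trajSum (f : E → ℝ) (g : E → E) : E → List ℝ → ℝ
  | _, [] => 0
  | x, a :: L => a * (f x + 2⁻¹ * (1 - a) * ‖g x‖ ^ 2) + trajSum f g (x - a • g x) L

lemma trajSum_append (f : E → ℝ) (g : E → E) (x : E) (s r : List ℝ) :
    trajSum f g x (s ++ r) = trajSum f g x s + trajSum f g (gdIter g x s) r := by
  induction s generalizing x with
  | nil => simp [trajSum, gdIter]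
  | cons a s ih => simp [trajSum, gdIter, ih, add_assoc]

/-- The terms of the primitive inequality combine to an expression that does not depend on the
reference value `h` and the reference point `y`. -/
lemma trajSum_eq (f : E → ℝ) (g : E → E) (h : ℝ) (y x : E) (L : List ℝ) :
    trajSum f g x L = L.sum * h + 2⁻¹ * ‖x - y‖ ^ 2 - 2⁻¹ * ‖gdIter g x L - y‖ ^ 2
      + ∑ i : Fin L.length,
          L.get i *
            (f (gdIter g x (L.take i.1)) - h
              - ⟪g (gdIter g x (L.take i.1)), gdIter g x (L.take i.1) - y⟫
              + 2⁻¹ * ‖g (gdIter g x (L.take i.1))‖ ^ 2) := by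
  induction L generalizing x with
  | nil => simp [trajSum, gdIter]
  | cons a L ih =>
    have hstep : ‖x - a • g x - y‖ ^ 2
        = ‖x - y‖ ^ 2 - 2 * a * ⟪g x, x - y⟫ + a ^ 2 * ‖g x‖ ^ 2 := by
      rw [show x - a • g x - y = (x - y) - a • g x by abel, norm_sub_sq_real,
        real_inner_smul_right, norm_smul, mul_pow, Real.norm_eq_abs, sq_abs, real_inner_comm]
      ring
    have hsum := Fin.sum_univ_succ (n := L.length) fun i : Fin (a :: L).length =>
      (a :: L).get i *
        (f (gdIter g x ((a :: L).take i.1)) - h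
          - ⟪g (gdIter g x ((a :: L).take i.1)), gdIter g x ((a :: L).take i.1) - y⟫
          + 2⁻¹ * ‖g (gdIter g x ((a :: L).take i.1))‖ ^ 2)
    simp only [List.get_cons_zero, List.get_cons_succ', Fin.val_zero, Fin.val_succ,
      List.take_zero, List.take_succ_cons, gdIter] at hsum
    rw [trajSum, ih, List.sum_cons, hstep]
    simp only [gdIter]
    refine Eq.trans ?_ (congrArg (_ + ·) hsum.symm)
    ring

/-- The primitive inequality in a form without reference point. -/
lemma primitive_ineq_iff (f : E → ℝ) (g : E → E) (h : ℝ) (y x : E) (L : List ℝ) (C : ℝ) :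
    (L.sum * (f (gdIter g x L) - h) + C * ‖g (gdIter g x L)‖ ^ 2
        + 2⁻¹ * ‖gdIter g x L - y‖ ^ 2
      ≤ 2⁻¹ * ‖x - y‖ ^ 2
        + ∑ i : Fin L.length,
            L.get i *
              (f (gdIter g x (L.take i.1)) - h
                - ⟪g (gdIter g x (L.take i.1)), gdIter g x (L.take i.1) - y⟫
                + 2⁻¹ * ‖g (gdIter g x (L.take i.1))‖ ^ 2)) ↔
    L.sum * f (gdIter g x L) + C * ‖g (gdIter g x L)‖ ^ 2 ≤ trajSum f g x L := by
  rw [trajSum_eq f g h y x L]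
  constructor <;> intro H <;> linarith

/-- Bound on `trajSum` with the reference point `p - g p` and reference value
`f p - ‖g p‖² / 2`. -/
lemma trajSum_le [CompleteSpace E] (hf : ConvexOn ℝ Set.univ f)
    (hg : ∀ y, HasGradientAt f (g y) y) (hlip : LipschitzWith 1 g) (p x : E) {L : List ℝ}
    (hL : ∀ a ∈ L, (0 : ℝ) < a) :
    trajSum f g x L ≤ L.sum * (f p - 2⁻¹ * ‖g p‖ ^ 2) + 2⁻¹ * ‖x - (p - g p)‖ ^ 2
      - 2⁻¹ * ‖gdIter g x L - (p - g p)‖ ^ 2 := by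
  rw [trajSum_eq f g (f p - 2⁻¹ * ‖g p‖ ^ 2) (p - g p) x L]
  refine add_le_of_nonpos_right (Finset.sum_nonpos fun i _ => ?_)
  refine mul_nonpos_of_nonneg_of_nonpos (hL _ (List.get_mem L i)).le ?_
  set q := gdIter g x (L.take i.1)
  have h := hf.add_inner_gradient_add_sq_le hg hlip q p
  rw [norm_sub_sq_real] at h
  rw [show q - (p - g p) = -(p - q) + g p by abel, inner_add_right, inner_neg_right]
  linarith

end Trajectory

lemma phi_sq {x y : ℝ} (hx : 0 ≤ x) (hy : 0 ≤ y) :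
    phi x y ^ 2 + (x + y) * phi x y = x * y + 2 * x + 2 * y + 2 := by
  have h := Real.sq_sqrt (show (0 : ℝ) ≤ (x + y + 2) ^ 2 + 4 * (x + 1) * (y + 1) by positivity)
  unfold phi
  linear_combination h / 4

lemma one_lt_phi {x y : ℝ} (hx : 0 ≤ x) (hy : 0 ≤ y) : 1 < phi x y := by
  have h : x + y + 2 < √((x + y + 2) ^ 2 + 4 * (x + 1) * (y + 1)) :=
    Real.lt_sqrt_of_sq_lt (lt_add_of_pos_right _ (by positivity))
  unfold phi
  linarith

lemma phi_lt_add_two {x y : ℝ} (hx : 0 ≤ x) (hy : 0 ≤ y) : phi x y < y + 2 := by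
  have h := phi_sq hx hy
  have h1 := one_lt_phi hx hy
  by_contra! hle
  nlinarith [mul_nonneg hx hy, mul_nonneg (add_nonneg hx hy) (sub_nonneg.2 hle)]

/-- The join inequality follows from the bounds relative to both endpoints and the two
interpolation inequalities. Here `uu, …, vw` are the inner products among the gradient `u` at the
last point, the gradient `v` at the join point and the displacement `w` in between, and `D` is the
difference of the function values. -/
lemma join_inequality {A B α D uu vv ww uv uw vw : ℝ} (hA : 0 ≤ A) (hB : 0 ≤ B)
    (hα : α = phi A B)
    (h1 : B * (D + 2⁻¹ * vv) + B * (B + 1) / 2 * uu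
      + 2⁻¹ * ((1 - α) ^ 2 * vv - 2 * (1 - α) * vw + ww) ≤ 2⁻¹ * (1 - α) ^ 2 * vv)
    (h2 : B * (2⁻¹ * uu) + B * (B + 1) / 2 * uu + 2⁻¹ * uu ≤ 2⁻¹ * (ww + 2 * uw + uu))
    (h3 : D + α * uv + uw + 2⁻¹ * (uu - 2 * uv + vv) ≤ 0)
    (h4 : -(α * vv) - vw + 2⁻¹ * (uu - 2 * uv + vv) ≤ D) :
    (A + α) * D + ((A + α + B) * (A + α + B + 1) / 2 - B * (B + 1) / 2) * uu
      ≤ 2⁻¹ * (A * (A + 1) + α - α ^ 2) * vv := by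
  have hsq : α ^ 2 + (A + B) * α = A * B + 2 * A + 2 * B + 2 := hα ▸ phi_sq hA hB
  have hα1 : 1 < α := hα ▸ one_lt_phi hA hB
  have hden : 0 < B + 2 - α := by
    have := hα ▸ phi_lt_add_two hA hB
    linarith
  set c := (A + α) / (B + 2 - α) with hc
  have hc0 : 0 ≤ c := div_nonneg (by linarith) hden.le
  have hcmul : c * (B + 2 - α) = A + α := div_mul_cancel₀ _ hden.ne'
  have huu : (A + α + B) * (A + α + B + 1) - B * (B + 1) = c * (2 * B ^ 2 + 3 * B + α) := by
    linear_combination (-(A + 2 * B + 1 + α)) * hcmul - c * hsq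
  have hvv : (A + 1) ^ 2 - (α - 1) ^ 2 = 2 * c * (α - 1) ^ 2 := by
    linear_combination (-(A + 2 - α)) * hcmul - c * hsq
  have H1 := mul_le_mul_of_nonneg_left h1 hc0
  have H2 := mul_le_mul_of_nonneg_left h2 hc0
  have H3 := mul_le_mul_of_nonneg_left h3 hc0
  have H4 := mul_le_mul_of_nonneg_left h4 (mul_nonneg hc0 (by linarith : 0 ≤ α - 1))
  have hD : (A + α) * (D + 2⁻¹ * vv) = c * (B + 2 - α) * (D + 2⁻¹ * vv) := by rw [hcmul]
  have huu' := congrArg (· * (2⁻¹ * uu)) huu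
  have hvv' := congrArg (· * (2⁻¹ * vv)) hvv
  linarith

lemma IsPrimitive.concatSched {s r : List ℝ} (hs : IsPrimitive s) (hr : IsPrimitive r) :
    IsPrimitive (concatSched s r) := by
  have hA : 0 ≤ s.sum := List.sum_nonneg fun a ha => (hs.1 a ha).le
  have hB : 0 ≤ r.sum := List.sum_nonneg fun a ha => (hr.1 a ha).le
  refine ⟨fun a ha => ?_, fun d f g hf hg hlip xstar hmin x => ?_⟩
  · rcases List.mem_append.1 ha with h | h
    · exact hs.1 a h
    · rcases List.mem_cons.1 h with rfl | h
      · exact zero_lt_one.trans (one_lt_phi hA hB)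
      · exact hr.1 a h
  have hsf := (primitive_ineq_iff f g _ _ _ _ _).1 (hs.2 d f g hf hg hlip xstar hmin x)
  rw [primitive_ineq_iff, _root_.concatSched, gdIter_append, trajSum_append]
  set p := gdIter g x s
  simp only [gdIter, trajSum, List.sum_append, List.sum_cons]
  generalize hα : phi s.sum r.sum = α
  set y := p - α • g p with hy
  have hrf := (primitive_ineq_iff f g _ _ _ _ _).1 (hr.2 d f g hf hg hlip xstar hmin y)
  have hp := trajSum_le hf hg hlip p y hr.1
  have hq := trajSum_le hf hg hlip (gdIter g y r) y hr.1
  set q := gdIter g y r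
  have hpq := hf.add_inner_gradient_add_sq_le hg hlip p q
  have hqp := hf.add_inner_gradient_add_sq_le hg hlip q p
  set w := y - q with hw
  rw [show y - (p - g p) = (1 - α) • g p by rw [hy]; module,
    show q - (p - g p) = (1 - α) • g p - w by rw [hw, hy]; module] at hp
  rw [show y - (q - g q) = w + g q by rw [hw]; abel,
    show q - (q - g q) = g q by abel] at hq
  rw [show q - p = -(α • g p) - w by rw [hw, hy]; abel, norm_sub_rev] at hpq
  rw [show p - q = α • g p + w by rw [hw, hy]; abel] at hqp
  simp only [norm_sub_sq_real, norm_add_sq_real, inner_add_right, inner_sub_right,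
    inner_neg_right, real_inner_smul_left, real_inner_smul_right, norm_smul, mul_pow,
    Real.norm_eq_abs, sq_abs, real_inner_self_eq_norm_sq] at hp hq hpq hqp
  rw [real_inner_comm] at hq
  have key := join_inequality (D := f q - f p) (uu := ‖g q‖ ^ 2) (vv := ‖g p‖ ^ 2)
    (ww := ‖w‖ ^ 2) (uv := ⟪g q, g p⟫) (uw := ⟪g q, w⟫) (vw := ⟪g p, w⟫) hA hB hα.symm
    (by linarith) (by linarith) (by linarith) (by linarith)
  linarith

/-- concatenating two primitive schedules with the join stepsize
`φ(Σ first part, Σ second part)` gives a primitive schedule. -/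
theorem primitive_of_concat (L : List ℝ) (hpos : ∀ a ∈ L, (0:ℝ) < a)
    (l : ℕ) (hl1 : 1 ≤ l) (hl2 : l ≤ L.length)
    (h1 : IsPrimitive (L.take (l - 1)))
    (h2 : IsPrimitive (L.drop l))
    (hjoin : L.getD (l - 1) 0 = phi (L.take (l - 1)).sum (L.drop l).sum) :
    IsPrimitive L := by
  have hlt : l - 1 < L.length := by omega
  have hget : L[l - 1] = phi (L.take (l - 1)).sum (L.drop l).sum := by
    rw [← hjoin, List.getD_eq_getElem L 0 hlt]
  have hL : L = concatSched (L.take (l - 1)) (L.drop l) := by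
    rw [concatSched, ← hget]
    conv_lhs => rw [← List.take_append_drop (l - 1) L, List.drop_eq_getElem_cons hlt]
    rw [Nat.sub_add_cancel hl1]
  rw [hL]
  exact h1.concatSched h2
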